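/- Let W₁ : (ℂ∖{0})² → ℂ be defined by W₁(z₁,z₂) = e^{−1}·(z₁ + z₂ + z₁^{−1}z₂^{−1} + z₂^{−1}). Then the set of critical points of W₁ (points where both partial derivatives ∂W₁/∂z₁ and ∂W₁/∂z₂ vanish) is exactly {(t, t^{−2}) : t ∈ ℂ, t⁴ + t³ − 1 = 0}, and this set has exactly four elements. -/

import Mathlib

/-- The Hori–Vafa superpotential of the Hirzebruch surface `𝔽₁` with anticanonical
Kähler parameters: `W₁(z₁,z₂) = e^{−1}(z₁ + z₂ + z₁⁻¹z₂⁻¹ + z₂⁻¹)`, regarded as a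
function on `ℂ × ℂ` (its restriction to `(ℂ∖{0})²` is the superpotential). -/
noncomputable def horiVafaW1 (p : ℂ × ℂ) : ℂ :=
  Complex.exp (-1) * (p.1 + p.2 + p.1⁻¹ * p.2⁻¹ + p.2⁻¹)

/-- The critical locus of `W₁` in `(ℂ∖{0})²`: both complex partial derivatives
vanish. -/
def horiVafaW1Crit : Set (ℂ × ℂ) :=
  {p : ℂ × ℂ | p.1 ≠ 0 ∧ p.2 ≠ 0 ∧
    deriv (fun w => horiVafaW1 (w, p.2)) p.1 = 0 ∧
    deriv (fun w => horiVafaW1 (p.1, w)) p.2 = 0}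

/-- The `z₁`-derivative of the superpotential. -/
theorem hasDerivAt_horiVafaW1_fst {a b : ℂ} (ha : a ≠ 0) :
    HasDerivAt (fun w => horiVafaW1 (w, b))
      (Complex.exp (-1) * (1 - (a ^ 2)⁻¹ * b⁻¹)) a := by
  have h := ((((hasDerivAt_id a).add_const b).add
    ((hasDerivAt_inv ha).mul_const b⁻¹)).add_const b⁻¹).const_mul (Complex.exp (-1))
  exact h.congr_deriv (by ring)

/-- The `z₂`-derivative of the superpotential. -/
theorem hasDerivAt_horiVafaW1_snd {a b : ℂ} (hb : b ≠ 0) :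
    HasDerivAt (fun w => horiVafaW1 (a, w))
      (Complex.exp (-1) * (1 - a⁻¹ * (b ^ 2)⁻¹ - (b ^ 2)⁻¹)) b := by
  have h := ((((hasDerivAt_id b).const_add a).add
    ((hasDerivAt_inv hb).const_mul a⁻¹)).add (hasDerivAt_inv hb)).const_mul (Complex.exp (-1))
  exact h.congr_deriv (by ring)

theorem horiVafaW1Crit_eq :
    horiVafaW1Crit =
      {p : ℂ × ℂ | ∃ t : ℂ, t ^ 4 + t ^ 3 - 1 = 0 ∧ p = (t, (t ^ 2)⁻¹)} := by
  ext ⟨a, b⟩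
  constructor
  · rintro ⟨ha, hb, h₁, h₂⟩
    dsimp only at ha hb h₁ h₂
    rw [(hasDerivAt_horiVafaW1_fst ha).deriv] at h₁
    rw [(hasDerivAt_horiVafaW1_snd hb).deriv] at h₂
    replace h₁ := (mul_eq_zero.mp h₁).resolve_left (Complex.exp_ne_zero _)
    replace h₂ := (mul_eq_zero.mp h₂).resolve_left (Complex.exp_ne_zero _)
    have hab : b = (a ^ 2)⁻¹ := by
      field_simp at h₁ ⊢
      linear_combination h₁
    refine ⟨a, ?_, by rw [hab]⟩
    subst hab
    field_simp at h₂
    linear_combination -h₂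
  · rintro ⟨t, ht, h⟩
    obtain ⟨rfl, rfl⟩ := Prod.mk.inj h
    have ha : a ≠ 0 := by
      rintro rfl
      norm_num at ht
    have hb : (a ^ 2)⁻¹ ≠ 0 := inv_ne_zero (pow_ne_zero 2 ha)
    refine ⟨ha, hb, ?_, ?_⟩
    · dsimp only
      rw [(hasDerivAt_horiVafaW1_fst ha).deriv]
      field_simp
      ring
    · dsimp only
      rw [(hasDerivAt_horiVafaW1_snd hb).deriv]
      refine mul_eq_zero_of_right _ ?_
      field_simp
      linear_combination -ht

open Polynomial in
theorem separable_X_pow_four_add_X_pow_three_sub_one :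
    (X ^ 4 + X ^ 3 - 1 : ℂ[X]).Separable := by
  have hC : (C (1 / 283) : ℂ[X]) * 283 = 1 := by
    rw [← map_ofNat C 283, ← C_mul]
    norm_num
  refine ⟨-C (1 / 283) * (256 * (X ^ 4 + X ^ 3 - 1) + 539),
    C (1 / 283) * (64 * X ^ 3 + 16 * X ^ 2 - 12 * X + 9) * (X ^ 2 + X), ?_⟩
  have hd : derivative (X ^ 4 + X ^ 3 - 1 : ℂ[X]) = 4 * X ^ 3 + 3 * X ^ 2 := by
    have h₄ : (C 4 : ℂ[X]) = 4 := map_ofNat C 4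
    have h₃ : (C 3 : ℂ[X]) = 3 := map_ofNat C 3
    norm_num [derivative_X_pow, -map_add, h₃, h₄]
  rw [hd]
  linear_combination hC

open Polynomial in
theorem encard_quartic_roots : {t : ℂ | t ^ 4 + t ^ 3 - 1 = 0}.encard = 4 := by
  have hdeg : (X ^ 4 + X ^ 3 - 1 : ℂ[X]).natDegree = 4 := by compute_degree!
  have hne : (X ^ 4 + X ^ 3 - 1 : ℂ[X]) ≠ 0 := by
    rintro h
    simp [h] at hdeg
  have hset : {t : ℂ | t ^ 4 + t ^ 3 - 1 = 0} =
      (X ^ 4 + X ^ 3 - 1 : ℂ[X]).rootSet ℂ := by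
    ext t
    simp [mem_rootSet, hne]
  have hcard := card_rootSet_eq_natDegree (K := ℂ)
    separable_X_pow_four_add_X_pow_three_sub_one (IsAlgClosed.splits _)
  rw [hdeg] at hcard
  rw [hset, Set.encard_eq_coe_toFinset_card, Set.toFinset_card, hcard]
  rfl

/-- The set of critical points of `W₁` is exactly
`{(t, t⁻²) : t⁴ + t³ − 1 = 0}`, and it has exactly four elements. -/
theorem horiVafaW1_critPoints :
    horiVafaW1Crit =
        {p : ℂ × ℂ | ∃ t : ℂ, t ^ 4 + t ^ 3 - 1 = 0 ∧ p = (t, (t ^ 2)⁻¹)} ∧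
      horiVafaW1Crit.encard = 4 := by
  refine ⟨horiVafaW1Crit_eq, ?_⟩
  have himage : horiVafaW1Crit =
      (fun t : ℂ => (t, (t ^ 2)⁻¹)) '' {t : ℂ | t ^ 4 + t ^ 3 - 1 = 0} := by
    rw [horiVafaW1Crit_eq]
    ext p
    simp [eq_comm]
  rw [himage, Function.Injective.encard_image fun _ _ h => (Prod.mk.inj h).1]
  exact encard_quartic_roots
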